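/- There exists a constant c > 0 with the following property: for every lattice L containing two incomparable elements (i.e., L is not a chain) and every integer m ≥ 1, there exist completely monotone functions f, h : L → ℝ taking values in [0,1] with f(x) = h(x)^m for all x ∈ L, such that for every function g : L → ℝ taking values in [0,1] for which the pointwise power g^{1/k} is completely monotone for every integer k ≥ 1, there exists x ∈ L with |f(x) − g(x)| ≥ c/m. -/

import Mathlib

/-- A function `f` on a lattice `L` is completely monotone if it is nonnegative and all its
successive discrete derivatives `Δ_{x_k} … Δ_{x_1} f (x) =
Σ_{J ⊆ [k]} (−1)^{|J|} f(x ∨ ⋁_{i∈J} x_i)` are nonnegative. -/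
def IsCM {L : Type*} [Lattice L] (f : L → ℝ) : Prop :=
  (∀ x, 0 ≤ f x) ∧
  ∀ (k : ℕ) (x : L) (y : Fin (k + 1) → L),
    0 ≤ ∑ J : Finset (Fin (k + 1)),
      (-1 : ℝ) ^ J.card * f (J.fold (· ⊔ ·) x y)

universe u

open Classical in
/-- Indicator of the principal ideal below `a`. -/
noncomputable def ideal_ind {L : Type*} [Lattice L] (a x : L) : ℝ := if x ≤ a then 1 else 0

theorem ideal_ind_sup {L : Type*} [Lattice L] (a x y : L) :
    ideal_ind a (x ⊔ y) = ideal_ind a x * ideal_ind a y := by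
  unfold ideal_ind
  by_cases h1 : x ≤ a <;> by_cases h2 : y ≤ a <;> simp [h1, h2]

theorem ideal_ind_cases {L : Type*} [Lattice L] (a x : L) :
    ideal_ind a x = 0 ∨ ideal_ind a x = 1 := by
  unfold ideal_ind
  by_cases h1 : x ≤ a <;> simp [h1]

theorem isCM_character {L : Type*} [Lattice L] (χ : L → ℝ)
    (hs : ∀ x y, χ (x ⊔ y) = χ x * χ y) (h0 : ∀ x, 0 ≤ χ x) (h1 : ∀ x, χ x ≤ 1) : IsCM χ := by
  refine ⟨h0, fun k x y => ?_⟩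
  have hf : ∀ J : Finset (Fin (k + 1)), χ (J.fold (· ⊔ ·) x y) = χ x * ∏ i ∈ J, χ (y i) := by
    intro J
    induction J using Finset.induction_on with
    | empty => simp
    | insert i J hi ih =>
      rw [Finset.fold_insert hi, Finset.prod_insert hi, hs, ih]; ring
  have key : ∑ J : Finset (Fin (k + 1)), (-1 : ℝ) ^ J.card * χ (J.fold (· ⊔ ·) x y)
      = χ x * ∏ i, (-χ (y i) + 1) := by
    rw [Finset.prod_add, Finset.mul_sum, Finset.powerset_univ]
    refine Finset.sum_congr rfl fun J _ => ?_
    rw [hf, Finset.prod_neg]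
    simp
    ring
  rw [key]
  exact mul_nonneg (h0 x) (Finset.prod_nonneg fun i _ => by linarith [h1 (y i)])

theorem isCM_add {L : Type*} [Lattice L] {f g : L → ℝ} (hf : IsCM f) (hg : IsCM g) :
    IsCM (fun x => f x + g x) := by
  refine ⟨fun x => add_nonneg (hf.1 x) (hg.1 x), fun k x y => ?_⟩
  have := add_nonneg (hf.2 k x y) (hg.2 k x y)
  rw [← Finset.sum_add_distrib] at this
  simpa only [mul_add] using this

theorem isCM_smul {L : Type*} [Lattice L] {f : L → ℝ} (hf : IsCM f) {c : ℝ} (hc : 0 ≤ c) :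
    IsCM (fun x => c * f x) := by
  refine ⟨fun x => mul_nonneg hc (hf.1 x), fun k x y => ?_⟩
  have := mul_nonneg hc (hf.2 k x y)
  rw [Finset.mul_sum] at this
  refine this.trans_eq (Finset.sum_congr rfl fun J _ => ?_)
  ring

theorem isCM_form {L : Type*} [Lattice L] (a b : L) {A B C D : ℝ} (hA : 0 ≤ A) (hB : 0 ≤ B)
    (hC : 0 ≤ C) (hD : 0 ≤ D) :
    IsCM (fun x => A * 1 + B * ideal_ind a x + C * ideal_ind b x
      + D * (ideal_ind a x * ideal_ind b x)) := by
  refine isCM_add (isCM_add (isCM_add (isCM_smul ?_ hA) (isCM_smul ?_ hB)) (isCM_smul ?_ hC))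
    (isCM_smul ?_ hD)
  · exact isCM_character _ (by simp) (by simp) (by simp)
  · refine isCM_character _ (ideal_ind_sup a) ?_ ?_ <;> intro x <;>
      rcases ideal_ind_cases a x with h | h <;> simp [h]
  · refine isCM_character _ (ideal_ind_sup b) ?_ ?_ <;> intro x <;>
      rcases ideal_ind_cases b x with h | h <;> simp [h]
  · refine isCM_character _ ?_ ?_ ?_
    · intro x y
      rw [ideal_ind_sup, ideal_ind_sup]; ring
    all_goals
      intro x
      rcases ideal_ind_cases a x with h | h <;> rcases ideal_ind_cases b x with h' | h' <;>
        simp [h, h']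

theorem pow_form {L : Type*} [Lattice L] (a b : L) {v α : ℝ} (hv : 0 ≤ v) (hα : 0 ≤ α) (m : ℕ) :
    ∃ A B C D : ℝ, 0 ≤ A ∧ 0 ≤ B ∧ 0 ≤ C ∧ 0 ≤ D ∧ ∀ x : L,
      (v + α * ideal_ind a x + α * ideal_ind b x) ^ m = A * 1 + B * ideal_ind a x
        + C * ideal_ind b x + D * (ideal_ind a x * ideal_ind b x) := by
  induction m with
  | zero => exact ⟨1, 0, 0, 0, by simp⟩
  | succ m ih =>
    obtain ⟨A, B, C, D, hA, hB, hC, hD, h⟩ := ih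
    refine ⟨A * v, A * α + B * v + B * α, A * α + C * v + C * α,
      B * α + C * α + D * v + D * α + D * α, by positivity, by positivity, by positivity,
      by positivity, fun x => ?_⟩
    rw [pow_succ, h]
    rcases ideal_ind_cases a x with h | h <;> rcases ideal_ind_cases b x with h' | h' <;>
        simp only [h, h'] <;> ring

theorem log_ineq {p q r s : ℝ} (hp : 0 < p) (hq : 0 < q) (hr : 0 < r) (hs : 0 < s)
    (h : ∀ k : ℕ, 1 ≤ k → q ^ (1 / (k : ℝ)) + r ^ (1 / (k : ℝ)) ≤
      p ^ (1 / (k : ℝ)) + s ^ (1 / (k : ℝ))) : q * r ≤ p * s := by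
  have hd : ∀ z : ℝ, 0 < z → HasDerivAt (fun t : ℝ => z ^ t) (Real.log z) 0 := by
    intro z hz
    simpa using (Real.hasStrictDerivAt_const_rpow hz 0).hasDerivAt
  have hF := (((hd p hp).add (hd s hs)).sub (hd q hq)).sub (hd r hr)
  have ht : Filter.Tendsto (fun n : ℕ => 1 / ((n : ℝ) + 1)) Filter.atTop (nhdsWithin 0 {0}ᶜ) := by
    rw [tendsto_nhdsWithin_iff]
    refine ⟨tendsto_one_div_add_atTop_nhds_zero_nat, Filter.Eventually.of_forall fun n => ?_⟩
    simp only [Set.mem_compl_iff, Set.mem_singleton_iff]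
    positivity
  have hl := (hasDerivAt_iff_tendsto_slope.1 hF).comp ht
  have h0 : 0 ≤ Real.log p + Real.log s - Real.log q - Real.log r := by
    refine ge_of_tendsto' hl fun n => ?_
    have hk := h (n + 1) (by omega)
    push_cast at hk
    simp only [Function.comp, slope_def_field, Pi.add_apply, Pi.sub_apply, Real.rpow_zero]
    apply div_nonneg
    · linarith
    · have : (0:ℝ) ≤ 1 / ((n : ℝ) + 1) := by positivity
      linarith
  rw [← Real.log_le_log_iff (by positivity) (by positivity), Real.log_mul hq.ne' hr.ne',
    Real.log_mul hp.ne' hs.ne']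
  linarith

theorem isCM_two {L : Type*} [Lattice L] {f : L → ℝ} (hf : IsCM f) (a b : L) :
    f a + f b ≤ f (a ⊓ b) + f (a ⊔ b) := by
  have h := hf.2 1 (a ⊓ b) ![a, b]
  have e : (Finset.univ : Finset (Finset (Fin 2))) = {∅, {0}, {1}, {0, 1}} := by decide
  have e2 : Finset.fold (((· ⊔ ·) : L → L → L)) (a ⊓ b) ![a, b] ({0, 1} : Finset (Fin 2)) = a ⊔ b := by
    have e3 := Finset.fold_insert (op := ((· ⊔ ·) : L → L → L)) (b := a ⊓ b) (f := ![a, b])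
      (s := ({1} : Finset (Fin 2))) (a := 0) (by simp)
    refine e3.trans ?_
    rw [Finset.fold_singleton]
    simp
  have c2 : (({0, 1} : Finset (Fin 2))).card = 2 := by decide
  change 0 ≤ ∑ J : Finset (Fin 2), _ at h
  rw [e, Finset.sum_insert (by decide), Finset.sum_insert (by decide),
    Finset.sum_insert (by decide), Finset.sum_singleton, e2, c2] at h
  simp at h
  linarith

theorem num_gap (m : ℕ) (hm : 1 ≤ m) {v α : ℝ} (hα : α = 1 / (4 * m)) (hv : v = 1 - 2 * α) :
    1 / 2 ≤ v ^ m ∧ v ^ m + 1 / 32 / m ≤ (v + α) ^ m * (v + α) ^ m := by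
  have hm' : (1 : ℝ) ≤ m := by exact_mod_cast hm
  have ham : α * m = 1 / 4 := by rw [hα]; field_simp
  have hα0 : 0 < α := by rw [hα]; positivity
  have hα1 : α ≤ 1 / 4 := by nlinarith
  have hv0 : 0 < v := by linarith
  have hb : 1 / 2 ≤ v ^ m := by
    have := one_add_mul_le_pow (a := -(2 * α)) (by linarith) m
    rw [hv, sub_eq_add_neg]
    nlinarith
  refine ⟨hb, ?_⟩
  have e : (v + α) ^ m * (v + α) ^ m = v ^ m * (1 + α ^ 2 / v) ^ m := by
    rw [← mul_pow, ← mul_pow]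
    congr 1
    field_simp
    rw [hv]; ring
  have h1 := one_add_mul_le_pow (a := α ^ 2 / v) (by have : 0 ≤ α ^ 2 / v := by positivity
                                                     linarith) m
  have h2 : α ^ 2 ≤ α ^ 2 / v := by
    rw [le_div_iff₀ hv0]; nlinarith [sq_nonneg α]
  have h3 : 1 / 16 / (m : ℝ) ≤ m * (α ^ 2 / v) := by
    have : 1 / 16 / (m : ℝ) = m * α ^ 2 := by rw [hα]; field_simp; norm_num
    rw [this]; gcongr
  have h4 : 1 / 32 / (m : ℝ) = 1 / 2 * (1 / 16 / (m : ℝ)) := by ring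
  have h5 : 0 ≤ 1 / 16 / (m : ℝ) := by positivity
  rw [e, h4]
  calc _ ≤ v ^ m + v ^ m * (1 / 16 / (m : ℝ)) := by gcongr
    _ = v ^ m * (1 + 1 / 16 / (m : ℝ)) := by ring
    _ ≤ _ := by gcongr; linarith


/-- There is a universal constant `c > 0` such that on every lattice that is not a chain,
for every `m ≥ 1` there is an `m`-divisible completely monotone `[0,1]`-valued function
`f = h^m` whose distance to every infinitely divisible `[0,1]`-valued function is at
least `c/m`. -/
theorem stmt19 : ∃ c : ℝ, 0 < c ∧
    ∀ (L : Type u) [Lattice L], (∃ a b : L, ¬ a ≤ b ∧ ¬ b ≤ a) →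
    ∀ m : ℕ, 1 ≤ m →
    ∃ f h : L → ℝ, IsCM f ∧ IsCM h ∧
      (∀ x, f x ∈ Set.Icc (0 : ℝ) 1) ∧ (∀ x, h x ∈ Set.Icc (0 : ℝ) 1) ∧
      (∀ x, f x = h x ^ m) ∧
      ∀ g : L → ℝ, (∀ x, g x ∈ Set.Icc (0 : ℝ) 1) →
        (∀ k : ℕ, 1 ≤ k → IsCM (fun x => g x ^ (1 / (k : ℝ)))) →
        ∃ x, c / m ≤ |f x - g x| := by
  refine ⟨1 / 128, by norm_num, ?_⟩
  intro L _ ⟨a, b, hab, hba⟩ m hm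
  have hm' : (1 : ℝ) ≤ m := by exact_mod_cast hm
  obtain ⟨α, hα⟩ : ∃ α : ℝ, α = 1 / (4 * m) := ⟨_, rfl⟩
  obtain ⟨v, hv⟩ : ∃ v : ℝ, v = 1 - 2 * α := ⟨_, rfl⟩
  obtain ⟨hhalf, hgap⟩ := num_gap m hm hα hv
  have ham : α * m = 1 / 4 := by rw [hα]; field_simp
  have hα0 : 0 < α := by rw [hα]; positivity
  have hα1 : α ≤ 1 / 4 := by nlinarith
  have hv0 : 0 < v := by linarith
  obtain ⟨h, hh⟩ : ∃ h : L → ℝ, h = fun x => v + α * ideal_ind a x + α * ideal_ind b x :=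
    ⟨_, rfl⟩
  have hcm : ∀ n : ℕ, IsCM (fun x => h x ^ n) := by
    intro n
    obtain ⟨A, B, C, D, hA, hB, hC, hD, e⟩ := pow_form a b hv0.le hα0.le n
    have := isCM_form a b hA hB hC hD
    simp only [← e] at this
    rw [hh]; exact this
  have hI : ∀ x, h x ∈ Set.Icc v 1 := by
    intro x
    rw [hh]
    rcases ideal_ind_cases a x with h | h <;> rcases ideal_ind_cases b x with h' | h' <;>
      simp only [h, h', Set.mem_Icc] <;> constructor <;> linarith
  refine ⟨fun x => h x ^ m, h, hcm m, by simpa using hcm 1, ?_, ?_, fun _ => rfl, ?_⟩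
  · intro x
    have h0 := hv0.le.trans (hI x).1
    exact ⟨pow_nonneg h0 m, pow_le_one₀ h0 (hI x).2⟩
  · intro x
    exact ⟨hv0.le.trans (hI x).1, (hI x).2⟩
  intro g hg hid
  by_contra! hcon
  have hε : 1 / 128 / (m : ℝ) ≤ 1 / 128 := div_le_self (by norm_num) hm'
  have h32 : 1 / 32 / (m : ℝ) = 4 * (1 / 128 / (m : ℝ)) := by ring
  rw [h32] at hgap
  obtain ⟨ε, hεe⟩ : ∃ ε : ℝ, ε = 1 / 128 / (m : ℝ) := ⟨_, rfl⟩
  have hpos : 0 < ε := by rw [hεe]; positivity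
  rw [← hεe] at hε hgap hcon
  have hgpos : ∀ x, 0 < g x := by
    intro x
    have h1 : v ^ m ≤ h x ^ m := pow_le_pow_left₀ hv0.le (hI x).1 m
    have h2 := (abs_lt.1 (hcon x)).2
    linarith
  have hlog := log_ineq (hgpos (a ⊓ b)) (hgpos a) (hgpos b) (hgpos (a ⊔ b))
    (fun k hk => isCM_two (hid k hk) a b)
  have va : h a = v + α := by simp [hh, ideal_ind, hab]
  have vb : h b = v + α := by simp [hh, ideal_ind, hba]
  have vs : h (a ⊔ b) = v := by simp [hh, ideal_ind, hab, hba]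
  have ca := abs_lt.1 (hcon a)
  have cb := abs_lt.1 (hcon b)
  have cs := abs_lt.1 (hcon (a ⊔ b))
  rw [va] at ca
  rw [vb] at cb
  rw [vs] at cs
  have hu1 : (v + α) ^ m ≤ 1 := pow_le_one₀ (by linarith) (by linarith)
  have hp1 := (hg (a ⊓ b)).2
  have ha1 := (hg a).2
  have hs0 := hgpos (a ⊔ b)
  have hu0 : 0 ≤ (v + α) ^ m := by positivity
  obtain ⟨U, hU⟩ : ∃ U, U = (v + α) ^ m := ⟨_, rfl⟩
  rw [← hU] at hu0 hu1 ca cb hgap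
  have k1 : U * U ≤ U * (g b + ε) := by gcongr; linarith
  have k2 : U * g b ≤ (g a + ε) * g b := mul_le_mul_of_nonneg_right (by linarith) (hgpos b).le
  have k3 : g (a ⊓ b) * g (a ⊔ b) ≤ g (a ⊔ b) := mul_le_of_le_one_left hs0.le hp1
  have k4 : U * ε ≤ ε := mul_le_of_le_one_left hpos.le hu1
  have k5 : ε * g b ≤ ε := mul_le_of_le_one_right hpos.le (hg b).2
  nlinarith
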